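/- Fix n : ℕ, α ∈ (0,1), y ∈ ℝⁿ, and let p₀ : ℝⁿ → [0,∞) be a probability density (measurable, nonnegative, with ∫ p₀ dy₀ = 1 for Lebesgue measure). Assume the first posterior moment exists, i.e. y₀ ↦ ‖y₀‖ · K_α(y ∣ y₀) · p₀(y₀) is integrable. Then Tweedie's formula holds: gradient (fun y => Real.log (p_i y)) y = (1−α)⁻¹ • (√α • μ(y) − y), where μ(y) := ∫ y₀ · p_{0|i}(y₀ ∣ y) dy₀ is the posterior mean of the clean sample. -/

import Mathlib

open MeasureTheory

/-- The forward Gaussian kernel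
`K_α(y ∣ y₀) = (2π(1−α))^(−n/2) · exp(−‖y − √α·y₀‖² / (2(1−α)))`. -/
noncomputable def fwdK (n : ℕ) (α : ℝ) (y y₀ : EuclideanSpace ℝ (Fin n)) : ℝ :=
  (2 * Real.pi * (1 - α)) ^ (-(n : ℝ) / 2) *
    Real.exp (-‖y - Real.sqrt α • y₀‖ ^ 2 / (2 * (1 - α)))

lemma fwdK_pos (n : ℕ) {α : ℝ} (hα : α < 1) (y y₀ : EuclideanSpace ℝ (Fin n)) :
    0 < fwdK n α y y₀ := by
  have h : 0 < 1 - α := sub_pos.2 hα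
  unfold fwdK
  positivity

lemma continuous_fwdK (n : ℕ) (α : ℝ) (y : EuclideanSpace ℝ (Fin n)) :
    Continuous (fwdK n α y) := by
  unfold fwdK
  fun_prop

lemma fwdK_le (n : ℕ) {α : ℝ} (hα : α < 1) (y y₀ : EuclideanSpace ℝ (Fin n)) :
    fwdK n α y y₀ ≤ (2 * Real.pi * (1 - α)) ^ (-(n : ℝ) / 2) := by
  have h : 0 < 1 - α := sub_pos.2 hα
  refine mul_le_of_le_one_right (by positivity) (Real.exp_le_one_iff.2 ?_)
  rw [neg_div]
  exact neg_nonpos.2 (by positivity)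

lemma fwdK_mul_norm_le (n : ℕ) {α : ℝ} (hα : α ∈ Set.Ioo (0 : ℝ) 1)
    (y y₀ : EuclideanSpace ℝ (Fin n)) :
    fwdK n α y y₀ * ‖Real.sqrt α • y₀ - y‖ ≤ (2 * Real.pi * (1 - α)) ^ (-(n : ℝ) / 2) := by
  have h : 0 < 1 - α := sub_pos.2 hα.2
  rw [norm_sub_rev, fwdK, mul_assoc]
  refine mul_le_of_le_one_right (by positivity) ?_
  set t := ‖y - Real.sqrt α • y₀‖
  rw [neg_div, Real.exp_neg, inv_mul_le_one₀ (Real.exp_pos _)]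
  have hquad : t ^ 2 / 2 ≤ t ^ 2 / (2 * (1 - α)) := by
    apply div_le_div_of_nonneg_left (by positivity) (by positivity)
    linarith [hα.1]
  linarith [Real.add_one_le_exp (t ^ 2 / (2 * (1 - α))), sq_nonneg (t - 1)]

/-- The gradient of the forward kernel in its first argument. -/
lemma hasFDerivAt_fwdK (n : ℕ) (α : ℝ) (y y₀ : EuclideanSpace ℝ (Fin n)) :
    HasFDerivAt (fun y' => fwdK n α y' y₀)
      (innerSL ℝ ((fwdK n α y y₀ * (1 - α)⁻¹) • (Real.sqrt α • y₀ - y))) y := by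
  have h := (((((hasFDerivAt_id y).sub_const (Real.sqrt α • y₀)).norm_sq).neg.mul_const
    (2 * (1 - α))⁻¹).exp).const_mul ((2 * Real.pi * (1 - α)) ^ (-(n : ℝ) / 2))
  simp only [← div_eq_mul_inv] at h
  refine h.congr_fderiv ?_
  ext v
  simp [fwdK]
  ring

lemma integrable_fwdK_mul (n : ℕ) {α : ℝ} (hα : α < 1) (y : EuclideanSpace ℝ (Fin n))
    {p : EuclideanSpace ℝ (Fin n) → ℝ} (hp : Integrable p) :
    Integrable (fun y₀ => fwdK n α y y₀ * p y₀) :=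
  hp.bdd_mul (continuous_fwdK n α y).aestronglyMeasurable
    (.of_forall fun y₀ => by
      rw [Real.norm_of_nonneg (fwdK_pos n hα y y₀).le]
      exact fwdK_le n hα y y₀)

lemma integral_fwdK_mul_pos (n : ℕ) {α : ℝ} (hα : α < 1) (y : EuclideanSpace ℝ (Fin n))
    {p : EuclideanSpace ℝ (Fin n) → ℝ} (hp : Integrable p) (hp_nonneg : ∀ y₀, 0 ≤ p y₀)
    (hp_pos : 0 < ∫ y₀, p y₀) : 0 < ∫ y₀, fwdK n α y y₀ * p y₀ := by
  rw [integral_pos_iff_support_of_nonneg hp_nonneg hp] at hp_pos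
  rw [integral_pos_iff_support_of_nonneg
    (fun y₀ => mul_nonneg (fwdK_pos n hα y y₀).le (hp_nonneg y₀)) (integrable_fwdK_mul n hα y hp)]
  convert hp_pos using 2
  ext y₀
  simp [(fwdK_pos n hα y y₀).ne']

lemma hasFDerivAt_integral_fwdK_mul (n : ℕ) {α : ℝ} (hα : α ∈ Set.Ioo (0 : ℝ) 1)
    (y : EuclideanSpace ℝ (Fin n)) {p : EuclideanSpace ℝ (Fin n) → ℝ} (hp : Integrable p) :
    HasFDerivAt (fun y' => ∫ y₀, fwdK n α y' y₀ * p y₀)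
      (∫ y₀, p y₀ • innerSL ℝ ((fwdK n α y y₀ * (1 - α)⁻¹) • (Real.sqrt α • y₀ - y))) y := by
  have h : 0 < 1 - α := sub_pos.2 hα.2
  refine hasFDerivAt_integral_of_dominated_of_fderiv_le (s := Set.univ) (𝕜 := ℝ)
    (F' := fun x y₀ => p y₀ • innerSL ℝ ((fwdK n α x y₀ * (1 - α)⁻¹) • (Real.sqrt α • y₀ - x)))
    (bound := fun y₀ => |p y₀| * ((2 * Real.pi * (1 - α)) ^ (-(n : ℝ) / 2) * (1 - α)⁻¹))
    Filter.univ_mem (.of_forall fun x => (integrable_fwdK_mul n hα.2 x hp).aestronglyMeasurable)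
    (integrable_fwdK_mul n hα.2 y hp) ?_ (.of_forall fun y₀ x _ => ?_)
    (hp.abs.mul_const _) (.of_forall fun y₀ x _ => (hasFDerivAt_fwdK n α x y₀).mul_const (p y₀))
  · have hK := continuous_fwdK n α y
    refine hp.aestronglyMeasurable.smul (Continuous.aestronglyMeasurable ?_)
    exact (innerSL ℝ).continuous.comp (by fun_prop)
  · rw [norm_smul, innerSL_apply_norm, norm_smul, Real.norm_eq_abs, Real.norm_of_nonneg
      (mul_nonneg (fwdK_pos n hα.2 x y₀).le (inv_nonneg.2 h.le)), mul_right_comm]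
    gcongr
    exact fwdK_mul_norm_le n hα x y₀

/-- Tweedie's formula: if `p₀` is a probability density on ℝⁿ and the first posterior
moment exists (i.e. `y₀ ↦ ‖y₀‖ · K_α(y ∣ y₀) · p₀(y₀)` is integrable), then
`∇ (log p_i) (y) = (1−α)⁻¹ • (√α • μ(y) − y)`, where
`μ(y) = ∫ y₀ · p_{0|i}(y₀ ∣ y) dy₀` is the posterior mean of the clean sample and
`p_{0|i}(y₀ ∣ y) = K_α(y ∣ y₀) p₀(y₀) / p_i(y)` with
`p_i(y) = ∫ K_α(y ∣ y₀) p₀(y₀) dy₀`. -/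
theorem tweedie_formula
    (n : ℕ) (α : ℝ) (hα : α ∈ Set.Ioo (0 : ℝ) 1)
    (y : EuclideanSpace ℝ (Fin n))
    (p₀ : EuclideanSpace ℝ (Fin n) → ℝ)
    (hp₀_meas : Measurable p₀) (hp₀_nonneg : ∀ y₀, 0 ≤ p₀ y₀)
    (hp₀_one : (∫ y₀, p₀ y₀) = 1)
    (hmoment : Integrable (fun y₀ => ‖y₀‖ * (fwdK n α y y₀ * p₀ y₀))) :
    gradient (fun y' => Real.log (∫ y₀, fwdK n α y' y₀ * p₀ y₀)) y
      = (1 - α)⁻¹ •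
          (Real.sqrt α •
              (∫ y₀, ((fwdK n α y y₀ * p₀ y₀) / (∫ y₀', fwdK n α y y₀' * p₀ y₀')) • y₀)
            - y) := by
  have hp : Integrable p₀ := by
    by_contra h
    rw [integral_undef h] at hp₀_one
    exact zero_ne_one hp₀_one
  have hpos := integral_fwdK_mul_pos n hα.2 y hp hp₀_nonneg (hp₀_one ▸ one_pos)
  have hK := integrable_fwdK_mul n hα.2 y hp
  have hmean : Integrable (fun y₀ => (fwdK n α y y₀ * p₀ y₀) • y₀) := by
    refine hmoment.mono (hK.aestronglyMeasurable.smul aestronglyMeasurable_id) (.of_forall ?_)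
    intro y₀
    simp [norm_smul, mul_comm]
  have hlog := (hasFDerivAt_integral_fwdK_mul n hα y hp).log hpos.ne'
  refine HasGradientAt.gradient (hasGradientAt_iff_hasFDerivAt.2 (hlog.congr_fderiv ?_))
  have hsplit : ∀ y₀, p₀ y₀ • innerSL ℝ ((fwdK n α y y₀ * (1 - α)⁻¹) • (Real.sqrt α • y₀ - y)) =
      innerSL ℝ ((1 - α)⁻¹ • (Real.sqrt α • ((fwdK n α y y₀ * p₀ y₀) • y₀)
        - (fwdK n α y y₀ * p₀ y₀) • y)) := by
    intro y₀
    rw [← map_smul]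
    congr 1
    module
  simp only [hsplit]
  have hscaled : Integrable (fun y₀ => Real.sqrt α • ((fwdK n α y y₀ * p₀ y₀) • y₀)) :=
    hmean.smul (Real.sqrt α)
  have hconst := hK.smul_const y
  have hscore : Integrable (fun y₀ => (1 - α)⁻¹ • (Real.sqrt α • ((fwdK n α y y₀ * p₀ y₀) • y₀)
      - (fwdK n α y y₀ * p₀ y₀) • y)) :=
    (hscaled.sub hconst).smul (1 - α)⁻¹
  rw [(innerSL ℝ).integral_comp_comm hscore, integral_smul, integral_sub hscaled hconst,
    integral_smul, integral_smul_const, ← map_smul]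
  simp only [div_eq_inv_mul, mul_smul _ (fwdK n α y _ * p₀ _), integral_smul]
  set c := ∫ y₀, fwdK n α y y₀ * p₀ y₀
  have hvec : ∀ m : EuclideanSpace ℝ (Fin n),
      c⁻¹ • (1 - α)⁻¹ • (Real.sqrt α • m - c • y)
        = (1 - α)⁻¹ • (Real.sqrt α • c⁻¹ • m - y) := by
    intro m
    rw [smul_comm c⁻¹, smul_sub c⁻¹, smul_comm c⁻¹, inv_smul_smul₀ hpos.ne']
  rw [hvec]
  rfl
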